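/- Define the quadratic penalty function Φ_ρ(x) = 𝕃_ρ(x,0,0) = f(x) + (ρ/2) Σ_{i∈E} c_i(x)² + (ρ/2) Σ_{i∈I} max(c_i(x),0)². Assume f is bounded from below on ℝ^n, and there exists ρ̄ > 0 such that for every ρ ≥ ρ̄ the function Φ_ρ is lower semicontinuous and level-bounded (every sublevel set {x : Φ_ρ(x) ≤ α} is bounded). Then strong duality holds when the penalty parameter is treated as a dual variable: sup_{ρ>0, λ∈ℝ^E, μ∈ℝ^I} inf_{x∈ℝ^n} 𝕃_ρ(x,λ,μ) = inf_{x∈ℝ^n} sup_{ρ>0, λ∈ℝ^E, μ∈ℝ^I} 𝕃_ρ(x,λ,μ), and the common value equals the optimal value inf { f(x) : x feasible for (P) }, in the extended reals. -/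

import Mathlib

open scoped BigOperators

/-- The Hestenes–Powell–Rockafellar augmented Lagrangian for the nonlinear program
`min f(x) s.t. cE i x = 0 (i ∈ E), cI i x ≤ 0 (i ∈ I)`. -/
noncomputable def AL {n : ℕ} {E I : Type*} [Fintype E] [Fintype I]
    (f : (Fin n → ℝ) → ℝ) (cE : E → (Fin n → ℝ) → ℝ) (cI : I → (Fin n → ℝ) → ℝ)
    (ρ : ℝ) (x : Fin n → ℝ) (lam : E → ℝ) (μ : I → ℝ) : ℝ :=
  f x + ∑ i, lam i * cE i x + (ρ / 2) * ∑ i, (cE i x) ^ 2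
    + (ρ / 2) * ∑ i, ((max (μ i / ρ + cI i x) 0) ^ 2 - (μ i) ^ 2 / ρ ^ 2)

/-- Feasibility for the nonlinear program (P). -/
def Feasible {n : ℕ} {E I : Type*}
    (cE : E → (Fin n → ℝ) → ℝ) (cI : I → (Fin n → ℝ) → ℝ) (x : Fin n → ℝ) : Prop :=
  (∀ i, cE i x = 0) ∧ (∀ i, cI i x ≤ 0)

/-- The squared constraint violation penalized by the augmented Lagrangian at zero multipliers. -/
noncomputable def sqViolation {n : ℕ} {E I : Type*} [Fintype E] [Fintype I]
    (cE : E → (Fin n → ℝ) → ℝ) (cI : I → (Fin n → ℝ) → ℝ) (x : Fin n → ℝ) : ℝ :=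
  ∑ i, (cE i x) ^ 2 + ∑ i, (max (cI i x) 0) ^ 2

section

variable {n : ℕ} {E I : Type*} [Fintype E] [Fintype I]
  (f : (Fin n → ℝ) → ℝ) (cE : E → (Fin n → ℝ) → ℝ) (cI : I → (Fin n → ℝ) → ℝ)

theorem AL_zero_multipliers (ρ : ℝ) (x : Fin n → ℝ) :
    AL f cE cI ρ x 0 0 = f x + ρ / 2 * sqViolation cE cI x := by
  simp [AL, sqViolation]
  ring

theorem sqViolation_nonneg (x : Fin n → ℝ) : 0 ≤ sqViolation cE cI x := by
  unfold sqViolation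
  positivity

variable {cE cI} in
theorem feasible_of_sqViolation_eq_zero {x : Fin n → ℝ} (h : sqViolation cE cI x = 0) :
    Feasible cE cI x := by
  have hE : 0 ≤ ∑ i, (cE i x) ^ 2 := by positivity
  have hI : 0 ≤ ∑ i, (max (cI i x) 0) ^ 2 := by positivity
  unfold sqViolation at h
  have hE0 : ∑ i, (cE i x) ^ 2 = 0 := by linarith
  have hI0 : ∑ i, (max (cI i x) 0) ^ 2 = 0 := by linarith
  rw [Finset.sum_eq_zero_iff_of_nonneg fun i _ => sq_nonneg _] at hE0 hI0
  exact ⟨fun i => pow_eq_zero_iff two_ne_zero |>.1 (hE0 i (Finset.mem_univ i)),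
    fun i => max_eq_right_iff.1 (pow_eq_zero_iff two_ne_zero |>.1 (hI0 i (Finset.mem_univ i)))⟩

variable {cE cI} in
theorem AL_le_of_feasible {x : Fin n → ℝ} (hx : Feasible cE cI x) {ρ : ℝ} (hρ : 0 < ρ)
    (lam : E → ℝ) (μ : I → ℝ) : AL f cE cI ρ x lam μ ≤ f x := by
  have hI : ∑ i, ((max (μ i / ρ + cI i x) 0) ^ 2 - (μ i) ^ 2 / ρ ^ 2) ≤ 0 := by
    refine Finset.sum_nonpos fun i _ => ?_
    rw [← div_pow, sub_nonpos, sq_le_sq, abs_of_nonneg (le_max_right _ _)]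
    exact max_le (by linarith [hx.2 i, le_abs_self (μ i / ρ)]) (abs_nonneg _)
  have := mul_nonpos_of_nonneg_of_nonpos (half_pos hρ).le hI
  simp only [AL, hx.1]
  simp only [mul_zero, Finset.sum_const_zero, ne_eq, OfNat.ofNat_ne_zero, not_false_eq_true,
    zero_pow, add_zero]
  linarith

variable {f cE cI} in
/-- If the quadratic penalty functions attain values at most `r` for all large parameters,
then some feasible point has objective value at most `r`. -/
theorem exists_feasible_le_of_forall_penalty_le {ρbar : ℝ}
    (hpen : ∀ ρ : ℝ, ρbar ≤ ρ → LowerSemicontinuous (fun x => AL f cE cI ρ x 0 0) ∧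
      ∀ r : ℝ, Bornology.IsBounded {x : Fin n → ℝ | AL f cE cI ρ x 0 0 ≤ r})
    {r : ℝ} (h : ∀ ρ, ρbar ≤ ρ → ∃ x, AL f cE cI ρ x 0 0 ≤ r) (hρbar : 0 < ρbar) :
    ∃ x, Feasible cE cI x ∧ f x ≤ r := by
  have hρ : ∀ k : ℕ, ρbar ≤ ρbar + k := fun k => le_add_of_nonneg_right k.cast_nonneg
  have hclosed : ∀ k : ℕ, IsClosed {x | AL f cE cI (ρbar + k) x 0 0 ≤ r} := fun k =>
    (hpen _ (hρ k)).1.isClosed_preimage r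
  obtain ⟨x, hx⟩ := IsCompact.nonempty_iInter_of_sequence_nonempty_isCompact_isClosed
    (fun k : ℕ => {x | AL f cE cI (ρbar + k) x 0 0 ≤ r})
    (fun k x hx => by
      simp only [Set.mem_ofPred_eq, AL_zero_multipliers, Nat.cast_succ] at hx ⊢
      linarith [sqViolation_nonneg cE cI x])
    (fun k => h _ (hρ k))
    (Metric.isCompact_of_isClosed_isBounded (hclosed 0) ((hpen _ (hρ 0)).2 r))
    hclosed
  simp only [Set.mem_iInter, Set.mem_ofPred_eq, AL_zero_multipliers] at hx
  have hv := sqViolation_nonneg cE cI x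
  refine ⟨x, feasible_of_sqViolation_eq_zero (hv.eq_or_lt.resolve_right fun hpos => ?_).symm, ?_⟩
  · obtain ⟨k, hk⟩ := exists_nat_gt ((r - f x) / (sqViolation cE cI x / 2))
    rw [div_lt_iff₀ (half_pos hpos)] at hk
    linarith [hx k, mul_pos hρbar hpos]
  · have := hx 0
    have := mul_nonneg hρbar.le hv
    simp only [Nat.cast_zero, add_zero] at *
    linarith

end

/-- If `f` is bounded below and the quadratic penalty `Φ_ρ = 𝕃_ρ(·,0,0)` is lower
semicontinuous and level-bounded for all large `ρ`, then strong duality holds with the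
penalty parameter treated as a dual variable, and the common value is the optimal value
of (P). -/
theorem AL_strong_duality_nonconvex {n : ℕ} {E I : Type*} [Fintype E] [Fintype I]
    (f : (Fin n → ℝ) → ℝ) (cE : E → (Fin n → ℝ) → ℝ) (cI : I → (Fin n → ℝ) → ℝ)
    (hbdd : BddBelow (Set.range f))
    (hpen : ∃ ρbar : ℝ, 0 < ρbar ∧ ∀ ρ : ℝ, ρbar ≤ ρ →
      LowerSemicontinuous (fun x => AL f cE cI ρ x 0 0) ∧
      ∀ r : ℝ, Bornology.IsBounded {x : Fin n → ℝ | AL f cE cI ρ x 0 0 ≤ r}) :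
    (⨆ (ρ : ℝ) (_ : 0 < ρ) (lam : E → ℝ) (μ : I → ℝ),
        ⨅ x : Fin n → ℝ, (AL f cE cI ρ x lam μ : EReal))
      = (⨅ x : Fin n → ℝ, ⨆ (ρ : ℝ) (_ : 0 < ρ) (lam : E → ℝ) (μ : I → ℝ),
          (AL f cE cI ρ x lam μ : EReal)) ∧
    (⨅ x : Fin n → ℝ, ⨆ (ρ : ℝ) (_ : 0 < ρ) (lam : E → ℝ) (μ : I → ℝ),
        (AL f cE cI ρ x lam μ : EReal))
      = ⨅ (x : Fin n → ℝ) (_ : Feasible cE cI x), (f x : EReal) := by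
  obtain ⟨ρbar, hρbar, hpen⟩ := hpen
  have hweak : (⨆ (ρ : ℝ) (_ : 0 < ρ) (lam : E → ℝ) (μ : I → ℝ),
      ⨅ x : Fin n → ℝ, (AL f cE cI ρ x lam μ : EReal))
      ≤ ⨅ x : Fin n → ℝ, ⨆ (ρ : ℝ) (_ : 0 < ρ) (lam : E → ℝ) (μ : I → ℝ),
        (AL f cE cI ρ x lam μ : EReal) :=
    le_iInf fun x => iSup₂_mono fun ρ _ => iSup₂_mono fun lam μ => iInf_le _ x
  have hprimal : (⨅ x : Fin n → ℝ, ⨆ (ρ : ℝ) (_ : 0 < ρ) (lam : E → ℝ) (μ : I → ℝ),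
      (AL f cE cI ρ x lam μ : EReal))
      ≤ ⨅ (x : Fin n → ℝ) (_ : Feasible cE cI x), (f x : EReal) :=
    le_iInf₂ fun x hx => (iInf_le _ x).trans <| iSup₂_le fun ρ hρ => iSup₂_le fun lam μ =>
      EReal.coe_le_coe_iff.2 (AL_le_of_feasible f hx hρ lam μ)
  have hstrong : (⨅ (x : Fin n → ℝ) (_ : Feasible cE cI x), (f x : EReal))
      ≤ ⨆ (ρ : ℝ) (_ : 0 < ρ) (lam : E → ℝ) (μ : I → ℝ),
        ⨅ x : Fin n → ℝ, (AL f cE cI ρ x lam μ : EReal) := by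
    by_contra! hlt
    obtain ⟨r, hr, hr'⟩ := EReal.lt_iff_exists_real_btwn.1 hlt
    obtain ⟨x, hx, hxr⟩ := exists_feasible_le_of_forall_penalty_le hpen (r := r)
      (fun ρ hρ => by
        have hdual : (⨅ x : Fin n → ℝ, (AL f cE cI ρ x 0 0 : EReal)) < r :=
          (le_iSup₂_of_le ρ (hρbar.trans_le hρ) <| le_iSup₂_of_le (f := fun (lam : E → ℝ) (μ : I → ℝ) =>
              ⨅ x : Fin n → ℝ, (AL f cE cI ρ x lam μ : EReal)) 0 0 le_rfl).trans_lt hr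
        obtain ⟨x, hx⟩ := iInf_lt_iff.1 hdual
        exact ⟨x, (EReal.coe_lt_coe_iff.1 hx).le⟩) hρbar
    exact (hr'.trans_le (iInf₂_le x hx)).not_ge (EReal.coe_le_coe_iff.2 hxr)
  exact ⟨hweak.antisymm (hprimal.trans hstrong), hprimal.antisymm (hstrong.trans hweak)⟩
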